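/- Let Ω be a measurable subset of ℝ^d, V a real inner product space, W : V → ℝ a convex function, and G₀, S₀, Ĝ, Ŝ : ℝ^d → V measurable fields. For τ ∈ V with {⟪τ, ε'⟫ - W ε' : ε'} bounded above, let W*(τ) = ⨆ ε', (⟪τ, ε'⟫ - W ε'). Assume for almost every x ∈ Ω: (i) W has gradient S₀ x at G₀ x, (ii) the sets defining W*(S₀ x) and W*(Ŝ x) are bounded above, and (iii) the orthogonality ∫_Ω ⟪Ŝ x - S₀ x, Ĝ x - G₀ x⟫ dx = 0 holds (it follows from Green's formula when the pairs are kinematically and statically admissible). Assume all integrands below are integrable on Ω. Then the constitutive relation error Ψ = ∫_Ω [W(Ĝ x) + W*(Ŝ x) - ⟪Ŝ x, Ĝ x⟫] dx satisfies Ψ = φ + ψ, Ψ ≥ φ, and Ψ ≥ ψ, where φ = ∫_Ω [W(Ĝ x) - W(G₀ x) - ⟪S₀ x, Ĝ x - G₀ x⟫] dx and ψ = ∫_Ω [W*(Ŝ x) - W*(S₀ x) - ⟪Ŝ x - S₀ x, G₀ x⟫] dx. (Proposition 3.3: Ψ(û, σ̂) = φ(û - u) + ψ(σ̂ - σ) ≥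 max{φ(û - u), ψ(σ̂ - σ)}, the energy-based error bound.) -/

import Mathlib

open MeasureTheory RealInnerProductSpace

/-- A convex function lies above its tangent hyperplane at a point of differentiability. -/
theorem ConvexOn.add_inner_le_of_hasGradientAt {V : Type*}
    [NormedAddCommGroup V] [InnerProductSpace ℝ V] [CompleteSpace V]
    {W : V → ℝ} (hW : ConvexOn ℝ Set.univ W) {s g : V} (h : HasGradientAt W s g) (y : V) :
    W g + ⟪s, y - g⟫ ≤ W y := by
  have hconv : ConvexOn ℝ Set.univ (W ∘ AffineMap.lineMap (k := ℝ) g y) := by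
    simpa using hW.comp_affineMap (AffineMap.lineMap (k := ℝ) g y)
  have hderiv : HasDerivAt (W ∘ AffineMap.lineMap (k := ℝ) g y) ⟪s, y - g⟫ 0 := by
    have h' : HasFDerivAt W (InnerProductSpace.toDual ℝ V s)
        (AffineMap.lineMap (k := ℝ) g y 0) := by
      simpa using h.hasFDerivAt
    simpa using h'.comp_hasDerivAt (0 : ℝ) AffineMap.hasDerivAt_lineMap
  have hslope := hconv.le_slope_of_hasDerivAt (Set.mem_univ 0) (Set.mem_univ 1) one_pos hderiv
  simp [slope_def_field] at hslope
  linarith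

/-- Equality in the Fenchel–Young inequality at a gradient of a convex function. -/
theorem ConvexOn.iSup_inner_sub_eq_of_hasGradientAt {V : Type*}
    [NormedAddCommGroup V] [InnerProductSpace ℝ V] [CompleteSpace V]
    {W : V → ℝ} (hW : ConvexOn ℝ Set.univ W) {s g : V} (h : HasGradientAt W s g) :
    (⨆ y : V, (⟪s, y⟫ - W y)) = ⟪s, g⟫ - W g := by
  have hle (y : V) : ⟪s, y⟫ - W y ≤ ⟪s, g⟫ - W g := by
    have := hW.add_inner_le_of_hasGradientAt h y
    rw [inner_sub_right] at this
    linarith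
  exact le_antisymm (ciSup_le hle)
    (le_ciSup (f := fun y : V => ⟪s, y⟫ - W y) ⟨_, Set.forall_mem_range.2 hle⟩ g)

/-- Proposition 3.3: the constitutive relation error splits as
`Ψ(û, σ̂) = φ(û - u) + ψ(σ̂ - σ)` and bounds each generalization error from
above, `Ψ ≥ φ` and `Ψ ≥ ψ` (the energy-based error bound), where
`W*(τ) = ⨆ ε', (⟪τ, ε'⟫ - W ε')` is the Legendre transform of the convex
energy density `W`. -/
theorem cre_error_bound {d : ℕ} {V : Type*}
    [NormedAddCommGroup V] [InnerProductSpace ℝ V] [CompleteSpace V]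
    [MeasurableSpace V] [BorelSpace V]
    (Ω : Set (EuclideanSpace ℝ (Fin d))) (hΩ : MeasurableSet Ω)
    (W : V → ℝ) (hW : ConvexOn ℝ Set.univ W)
    (G₀ S₀ Ghat Shat : EuclideanSpace ℝ (Fin d) → V)
    (hG₀ : Measurable G₀) (hS₀ : Measurable S₀)
    (hGhat : Measurable Ghat) (hShat : Measurable Shat)
    (hae : ∀ᵐ x ∂(volume.restrict Ω),
      HasGradientAt W (S₀ x) (G₀ x) ∧
      BddAbove (Set.range fun ε' : V => ⟪S₀ x, ε'⟫ - W ε') ∧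
      BddAbove (Set.range fun ε' : V => ⟪Shat x, ε'⟫ - W ε'))
    (hintX : IntegrableOn (fun x => ⟪Shat x - S₀ x, Ghat x - G₀ x⟫) Ω)
    (horth : ∫ x in Ω, ⟪Shat x - S₀ x, Ghat x - G₀ x⟫ = 0)
    (hintΨ : IntegrableOn (fun x =>
      W (Ghat x) + (⨆ ε' : V, (⟪Shat x, ε'⟫ - W ε')) - ⟪Shat x, Ghat x⟫) Ω)
    (hintφ : IntegrableOn
      (fun x => W (Ghat x) - W (G₀ x) - ⟪S₀ x, Ghat x - G₀ x⟫) Ω)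
    (hintψ : IntegrableOn (fun x =>
      (⨆ ε' : V, (⟪Shat x, ε'⟫ - W ε')) - (⨆ ε' : V, (⟪S₀ x, ε'⟫ - W ε'))
        - ⟪Shat x - S₀ x, G₀ x⟫) Ω) :
    (∫ x in Ω, (W (Ghat x) + (⨆ ε' : V, (⟪Shat x, ε'⟫ - W ε')) - ⟪Shat x, Ghat x⟫))
      = (∫ x in Ω, (W (Ghat x) - W (G₀ x) - ⟪S₀ x, Ghat x - G₀ x⟫))
        + (∫ x in Ω, ((⨆ ε' : V, (⟪Shat x, ε'⟫ - W ε'))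
            - (⨆ ε' : V, (⟪S₀ x, ε'⟫ - W ε')) - ⟪Shat x - S₀ x, G₀ x⟫)) ∧
    (∫ x in Ω, (W (Ghat x) - W (G₀ x) - ⟪S₀ x, Ghat x - G₀ x⟫))
      ≤ ∫ x in Ω, (W (Ghat x) + (⨆ ε' : V, (⟪Shat x, ε'⟫ - W ε')) - ⟪Shat x, Ghat x⟫) ∧
    (∫ x in Ω, ((⨆ ε' : V, (⟪Shat x, ε'⟫ - W ε'))
        - (⨆ ε' : V, (⟪S₀ x, ε'⟫ - W ε')) - ⟪Shat x - S₀ x, G₀ x⟫))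
      ≤ ∫ x in Ω, (W (Ghat x) + (⨆ ε' : V, (⟪Shat x, ε'⟫ - W ε')) - ⟪Shat x, Ghat x⟫) := by
  have hsplit : (∫ x in Ω, (W (Ghat x) + (⨆ ε' : V, (⟪Shat x, ε'⟫ - W ε')) - ⟪Shat x, Ghat x⟫))
      = (∫ x in Ω, (W (Ghat x) - W (G₀ x) - ⟪S₀ x, Ghat x - G₀ x⟫))
        + (∫ x in Ω, ((⨆ ε' : V, (⟪Shat x, ε'⟫ - W ε'))
            - (⨆ ε' : V, (⟪S₀ x, ε'⟫ - W ε')) - ⟪Shat x - S₀ x, G₀ x⟫)) := by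
    rw [← integral_add hintφ hintψ, ← add_zero (∫ x in Ω, (_ - ⟪Shat x, Ghat x⟫)), ← horth,
      ← integral_add hintΨ hintX]
    refine integral_congr_ae ?_
    filter_upwards [hae] with x hx
    simp only [hW.iSup_inner_sub_eq_of_hasGradientAt hx.1, inner_sub_left, inner_sub_right]
    ring
  have hφ : 0 ≤ ∫ x in Ω, (W (Ghat x) - W (G₀ x) - ⟪S₀ x, Ghat x - G₀ x⟫) := by
    refine integral_nonneg_of_ae ?_
    filter_upwards [hae] with x hx
    have := hW.add_inner_le_of_hasGradientAt hx.1 (Ghat x)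
    simp only [Pi.zero_apply]
    linarith
  have hψ : 0 ≤ ∫ x in Ω, ((⨆ ε' : V, (⟪Shat x, ε'⟫ - W ε'))
      - (⨆ ε' : V, (⟪S₀ x, ε'⟫ - W ε')) - ⟪Shat x - S₀ x, G₀ x⟫) := by
    refine integral_nonneg_of_ae ?_
    filter_upwards [hae] with x hx
    have := le_ciSup hx.2.2 (G₀ x)
    simp only [Pi.zero_apply, hW.iSup_inner_sub_eq_of_hasGradientAt hx.1, inner_sub_left]
    linarith
  exact ⟨hsplit, by linarith, by linarith⟩
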